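/- For any gender-neutral two-sided matching mechanism f with symmetry σ (σ(m_i) = w_i), the induced one-sided mechanism g on indices {1,...,n} — defined by evaluating f at the symmetric two-sided profile corresponding to a one-sided profile — is efficient whenever f is efficient. -/

import Mathlib

/- Two-sided matching framework.
Men and women are both indexed by `Fin n` (man `m_i` and woman `w_i` share index `i`,
reflecting the symmetry σ with σ(m_i) = w_i).  A two-sided matching is encoded as a
permutation `μ : Fin n ≃ Fin n`, where man `i` is matched with woman `μ i` (and woman
`j` with man `μ.symm j`).  A profile is a pair `(menPrefs, womenPrefs)`: man `i` has a
strict total order `P.1 i` over women's indices, and woman `j` has `P.2 j` over men's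
indices.  Under σ, the reflected profile of `P` is `(P.2, P.1)` and the reflection of
a matching `μ` is `μ.symm`. -/

abbrev Pref (A : Type) := {r : A → A → Prop // IsStrictTotalOrder A r}
abbrev Profile2 (n : ℕ) := (Fin n → Pref (Fin n)) × (Fin n → Pref (Fin n))
abbrev Mechanism2 (n : ℕ) := Profile2 n → (Fin n ≃ Fin n)

/-- Weak gender-neutrality with respect to σ(m_i) = w_i: reflecting the profile
reflects the outcome. -/
def WeaklyGN {n : ℕ} (f : Mechanism2 n) : Prop :=
  ∀ P : Profile2 n, f (P.2, P.1) = (f P).symm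

/-- `ν` Pareto dominates `μ` at the two-sided profile `P`. -/
def dominates2 {n : ℕ} (P : Profile2 n) (ν μ : Fin n ≃ Fin n) : Prop :=
  (∀ i, ν i = μ i ∨ (P.1 i).1 (ν i) (μ i)) ∧
  (∀ j, ν.symm j = μ.symm j ∨ (P.2 j).1 (ν.symm j) (μ.symm j)) ∧
  ((∃ i, (P.1 i).1 (ν i) (μ i)) ∨ (∃ j, (P.2 j).1 (ν.symm j) (μ.symm j)))

/-- Two-sided efficiency. -/
def Efficient2 {n : ℕ} (f : Mechanism2 n) : Prop :=
  ∀ P, ¬ ∃ ν : Fin n ≃ Fin n, dominates2 P ν (f P)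

/-- Two-sided group strategy-proofness: no coalition (of men `Sm` and women `Sw`)
has a misreport making all members weakly better off and some member strictly. -/
def GroupSP2 {n : ℕ} (f : Mechanism2 n) : Prop :=
  ¬ ∃ (P P' : Profile2 n) (Sm Sw : Set (Fin n)),
      (∀ i, i ∉ Sm → P'.1 i = P.1 i) ∧ (∀ j, j ∉ Sw → P'.2 j = P.2 j) ∧
      (∀ i ∈ Sm, f P' i = f P i ∨ (P.1 i).1 (f P' i) (f P i)) ∧
      (∀ j ∈ Sw, (f P').symm j = (f P).symm j ∨ (P.2 j).1 ((f P').symm j) ((f P).symm j)) ∧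
      ((∃ i ∈ Sm, (P.1 i).1 (f P' i) (f P i)) ∨
        (∃ j ∈ Sw, (P.2 j).1 ((f P').symm j) ((f P).symm j)))

/- The induced one-sided mechanism `g` on indices: for a one-sided profile
`Q : Fin n → Pref (Fin n)` (index `j` ranking the other indices, `j` itself meaning
"stay with own counterpart"), the corresponding symmetric two-sided profile is
`(Q, Q)`, and `g Q` sends `j` to `i` iff `f (Q, Q)` matches man `j` with woman `i`. -/

/-- If `f` is weakly gender-neutral and efficient, the induced one-sided mechanism is
efficient: its outcome is never Pareto dominated by a one-sided matching
(an involution on indices). -/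
theorem stmt11 {n : ℕ} (f : Mechanism2 n) (hgn : WeaklyGN f) (hE : Efficient2 f)
    (Q : Fin n → Pref (Fin n)) :
    ¬ ∃ μ : Fin n → Fin n, Function.Involutive μ ∧
      (∀ j, μ j = f (Q, Q) j ∨ (Q j).1 (μ j) (f (Q, Q) j)) ∧
      (∃ j, (Q j).1 (μ j) (f (Q, Q) j)) := by
  rintro ⟨μ, hμ, hweak, hstrict⟩
  have hsymm : (f (Q, Q)).symm = f (Q, Q) := (hgn (Q, Q)).symm
  refine hE (Q, Q) ⟨hμ.toPerm, hweak, fun j => ?_, Or.inl hstrict⟩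
  rw [hsymm]
  exact hweak j
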